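/- Let $1\le p_0<\infty$ and suppose $f,g\ge0$ satisfy: for every pair $(u_1,u_2)$ of weights with two-weight constant $\|(u_1,u_2)\|_{A_{p_0}}=1$, one has $\|g\|_{L^{p_0,\infty}(u_2)}\le\|f\|_{L^{p_0}(u_1)}$. Then for every positive locally integrable $u$ and all $y>0$: $u(\{g>y\}) \le c_{p_0}\, u(\{Mf>y\}) + y^{-1}\int_{\mathbb{R}^n} f(x)\, M(u\,\chi_{\{g>y\}})(x)\,dx$, where $c_{p_0}=1$ if $p_0>1$ and $c_{p_0}=0$ if $p_0=1$. -/

import Mathlib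

open MeasureTheory ENNReal Set

noncomputable section

/-- An axis-parallel cube in `ℝⁿ`. -/
def IsCube {n : ℕ} (Q : Set (Fin n → ℝ)) : Prop :=
  ∃ (a : Fin n → ℝ) (r : ℝ), 0 < r ∧ Q = Set.Icc a (fun i => a i + r)

/-- Average of `w` over a set `Q` (w.r.t. Lebesgue measure). -/
def cubeAvg {n : ℕ} (w : (Fin n → ℝ) → ℝ≥0∞) (Q : Set (Fin n → ℝ)) : ℝ≥0∞ :=
  (∫⁻ x in Q, w x) / volume Q

/-- Hardy–Littlewood maximal operator (over cubes containing the point). -/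
def maxOp {n : ℕ} (f : (Fin n → ℝ) → ℝ≥0∞) (x : Fin n → ℝ) : ℝ≥0∞ :=
  ⨆ (Q : Set (Fin n → ℝ)) (_ : IsCube Q) (_ : x ∈ Q), cubeAvg f Q

/-- `M_μ f = (M(f^{1/μ}))^μ`. -/
def maxOpP {n : ℕ} (μ : ℝ) (f : (Fin n → ℝ) → ℝ≥0∞) (x : Fin n → ℝ) : ℝ≥0∞ :=
  (maxOp (fun y => f y ^ (1 / μ)) x) ^ μ

/-- Muckenhoupt `A_p` constant; for `p = 1` the least `C` with `Mw ≤ C w` a.e. -/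
def apConst {n : ℕ} (p : ℝ) (w : (Fin n → ℝ) → ℝ≥0∞) : ℝ≥0∞ :=
  if p = 1 then
    sInf {C : ℝ≥0∞ | ∀ᵐ x ∂(volume : Measure (Fin n → ℝ)), maxOp w x ≤ C * w x}
  else
    ⨆ (Q : Set (Fin n → ℝ)) (_ : IsCube Q),
      cubeAvg w Q * (cubeAvg (fun x => w x ^ (-1 / (p - 1))) Q) ^ (p - 1)

/-- `A_∞` "constant": infimum of the `A_p` constants over `p > 1`. -/
def ainfConst {n : ℕ} (w : (Fin n → ℝ) → ℝ≥0∞) : ℝ≥0∞ :=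
  ⨅ (p : ℝ) (_ : 1 < p), apConst p w

/-- `u(E) = ∫_E u`. -/
def wMeas {n : ℕ} (w : (Fin n → ℝ) → ℝ≥0∞) (E : Set (Fin n → ℝ)) : ℝ≥0∞ :=
  ∫⁻ x in E, w x

/-- `‖g‖_{L^{p,∞}(w)} = sup_y y · w({g>y})^{1/p}`. -/
def wkNorm {n : ℕ} (p : ℝ) (w g : (Fin n → ℝ) → ℝ≥0∞) : ℝ≥0∞ :=
  ⨆ y : ℝ≥0∞, y * (wMeas w {x | y < g x}) ^ (1 / p)

/-- `‖f‖_{L^p(w)}`. -/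
def stNorm {n : ℕ} (p : ℝ) (w f : (Fin n → ℝ) → ℝ≥0∞) : ℝ≥0∞ :=
  (∫⁻ x, f x ^ p * w x) ^ (1 / p)

/-- A locally bounded function `φ : [0,∞] → [0,∞]`. -/
def LocBdd (φ : ℝ≥0∞ → ℝ≥0∞) : Prop :=
  ∀ M : ℝ≥0∞, M ≠ ⊤ → ∃ C : ℝ≥0∞, C ≠ ⊤ ∧ ∀ t ≤ M, φ t ≤ C

/-- A (a.e.) positive, locally integrable weight. -/
def PosLocInt {n : ℕ} (u : (Fin n → ℝ) → ℝ≥0∞) : Prop :=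
  Measurable u ∧ (∀ᵐ x ∂(volume : Measure (Fin n → ℝ)), 0 < u x) ∧
    ∀ Q : Set (Fin n → ℝ), IsCube Q → (∫⁻ x in Q, u x) < ⊤

end

noncomputable section

/-- Two-weight `A_p` constant of a pair `(u₁, u₂)`; for `p = 1` the least `C`
with `Mu₂ ≤ C u₁` a.e. -/
def twoApC {n : ℕ} (p : ℝ) (u₁ u₂ : (Fin n → ℝ) → ℝ≥0∞) : ℝ≥0∞ :=
  if p = 1 then
    sInf {C : ℝ≥0∞ | ∀ᵐ x ∂(volume : Measure (Fin n → ℝ)), maxOp u₂ x ≤ C * u₁ x}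
  else
    ⨆ (Q : Set (Fin n → ℝ)) (_ : IsCube Q),
      cubeAvg u₂ Q * (cubeAvg (fun x => u₁ x ^ (1 - p / (p - 1))) Q) ^ (p - 1)

theorem rpow_anti_neg {a b : ℝ≥0∞} {z : ℝ} (hz : z ≤ 0) (h : a ≤ b) : b ^ z ≤ a ^ z := by
  have h1 := ENNReal.rpow_le_rpow h (neg_nonneg.2 hz)
  rw [ENNReal.rpow_neg, ENNReal.rpow_neg] at h1
  exact ENNReal.inv_le_inv.1 h1

def bigQ (n : ℕ) (N : ℕ) : Set (Fin n → ℝ) :=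
  Set.Icc (fun _ => -((N : ℝ) + 1)) (fun _ => -((N : ℝ) + 1) + 2 * ((N : ℝ) + 1))

theorem bigQ_cube (n N : ℕ) : IsCube (bigQ n N) :=
  ⟨fun _ => -((N : ℝ) + 1), 2 * ((N : ℝ) + 1), by positivity, rfl⟩

theorem mem_bigQ {n N : ℕ} (x : Fin n → ℝ) : x ∈ bigQ n N ↔ ‖x‖ ≤ (N : ℝ) + 1 := by
  rw [pi_norm_le_iff_of_nonneg (by positivity)]
  simp only [bigQ, Set.mem_Icc, Pi.le_def, Real.norm_eq_abs, abs_le]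
  constructor
  · rintro ⟨h1, h2⟩ i
    exact ⟨h1 i, by linarith [h2 i]⟩
  · intro h
    exact ⟨fun i => (h i).1, fun i => by linarith [(h i).2]⟩

theorem bigQ_mono (n : ℕ) {N M : ℕ} (h : N ≤ M) : bigQ n N ⊆ bigQ n M := by
  intro x hx
  rw [mem_bigQ] at *
  have : (N : ℝ) ≤ M := by exact_mod_cast h
  linarith

theorem exists_mem_bigQ {n : ℕ} (x : Fin n → ℝ) : ∃ N, ∀ M, N ≤ M → x ∈ bigQ n M := by
  obtain ⟨N, hN⟩ := exists_nat_ge ‖x‖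
  refine ⟨N, fun M hM => bigQ_mono n hM ?_⟩
  rw [mem_bigQ]; linarith

theorem cube_vol {n : ℕ} {Q : Set (Fin n → ℝ)} (hQ : IsCube Q) :
    volume Q ≠ 0 ∧ volume Q ≠ ⊤ := by
  obtain ⟨a, r, hr, rfl⟩ := hQ
  rw [Real.volume_Icc_pi]
  constructor
  · rw [Finset.prod_ne_zero_iff]
    intro i _
    simpa using hr
  · exact ENNReal.prod_ne_top (fun i _ => ENNReal.ofReal_ne_top)

theorem cube_meas {n : ℕ} {Q : Set (Fin n → ℝ)} (hQ : IsCube Q) : MeasurableSet Q := by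
  obtain ⟨a, r, hr, rfl⟩ := hQ
  exact measurableSet_Icc

theorem cube_sub_bigQ {n : ℕ} {Q : Set (Fin n → ℝ)} (hQ : IsCube Q) :
    ∃ N, ∀ M, N ≤ M → Q ⊆ bigQ n M := by
  obtain ⟨a, r, hr, rfl⟩ := hQ
  obtain ⟨R, hR⟩ := (isCompact_Icc (a := a) (b := fun i => a i + r)).isBounded.exists_norm_le
  obtain ⟨N, hN⟩ := exists_nat_ge R
  refine ⟨N, fun M hM => Set.Subset.trans ?_ (bigQ_mono n hM)⟩
  intro x hx
  rw [mem_bigQ]; linarith [hR x hx]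

theorem iUnion_bigQ (n : ℕ) : (⋃ N, bigQ n N) = Set.univ := by
  refine Set.eq_univ_of_forall fun x => ?_
  obtain ⟨N, hN⟩ := exists_mem_bigQ x
  exact Set.mem_iUnion.2 ⟨N, hN N le_rfl⟩

theorem cubeAvg_le_maxOp {n : ℕ} (f : (Fin n → ℝ) → ℝ≥0∞) {Q : Set (Fin n → ℝ)}
    (hQ : IsCube Q) {x : Fin n → ℝ} (hx : x ∈ Q) : cubeAvg f Q ≤ maxOp f x :=
  le_iSup_of_le Q (le_iSup_of_le hQ (le_iSup_of_le hx le_rfl))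

theorem lt_maxOp_iff {n : ℕ} (f : (Fin n → ℝ) → ℝ≥0∞) (x : Fin n → ℝ) (t : ℝ≥0∞) :
    t < maxOp f x ↔ ∃ Q, IsCube Q ∧ x ∈ Q ∧ t < cubeAvg f Q := by
  simp only [maxOp, lt_iSup_iff, exists_prop]

theorem isOpen_maxOp {n : ℕ} (f : (Fin n → ℝ) → ℝ≥0∞) (t : ℝ≥0∞) :
    IsOpen {x | t < maxOp f x} := by
  rw [isOpen_iff_mem_nhds]
  intro x hx
  obtain ⟨Q, hQ, hxQ, ht⟩ := (lt_maxOp_iff f x t).1 hx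
  have ht' : t ≠ ⊤ := ne_top_of_lt ht
  have hv := cube_vol hQ
  obtain ⟨a, r, hr, rfl⟩ := hQ
  have h1 : t * volume (Set.Icc a (fun i => a i + r)) < ∫⁻ z in Set.Icc a (fun i => a i + r), f z :=
    (ENNReal.lt_div_iff_mul_lt (Or.inl hv.1) (Or.inl hv.2)).1 ht
  have hvol : ∀ s : ℝ, ∀ b : Fin n → ℝ,
      volume (Set.Icc b (fun i => b i + s)) = ENNReal.ofReal s ^ n := by
    intro s b
    rw [Real.volume_Icc_pi]; simp
  rw [hvol] at h1
  have hc : Continuous (fun e : ℝ => t * ENNReal.ofReal (r + 2 * e) ^ n) := by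
    refine ENNReal.continuous_const_mul ht' |>.comp ?_
    refine (ENNReal.continuous_pow n).comp ?_
    exact ENNReal.continuous_ofReal.comp (by fun_prop)
  have h2 : ∀ᶠ e in nhds (0 : ℝ), t * ENNReal.ofReal (r + 2 * e) ^ n
      < ∫⁻ z in Set.Icc a (fun i => a i + r), f z := by
    refine hc.continuousAt.eventually_lt continuousAt_const ?_
    simpa using h1
  obtain ⟨d, hd, hd2⟩ := Metric.eventually_nhds_iff.1 h2
  have h3 := hd2 (y := d / 2) (by rw [Real.dist_eq, sub_zero, abs_of_pos (by positivity)]; linarith)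
  set e := d / 2 with he
  have hepos : 0 < e := by positivity
  have hQ' : IsCube (Set.Icc (fun i => a i - e) (fun i => (a i - e) + (r + 2 * e))) :=
    ⟨fun i => a i - e, r + 2 * e, by positivity, rfl⟩
  have hv' := cube_vol hQ'
  have h4 : t < cubeAvg f (Set.Icc (fun i => a i - e) (fun i => (a i - e) + (r + 2 * e))) := by
    rw [cubeAvg, ENNReal.lt_div_iff_mul_lt (Or.inl hv'.1) (Or.inl hv'.2),
      hvol (r + 2 * e) (fun i => a i - e)]
    refine h3.trans_le (lintegral_mono_set ?_)
    intro z hz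
    exact ⟨fun i => by linarith [hz.1 i], fun i => by have := hz.2 i; simp only at this; linarith⟩
  refine Filter.mem_of_superset (Metric.closedBall_mem_nhds x hepos) ?_
  intro z hz
  refine (lt_maxOp_iff f z t).2 ⟨_, hQ', ?_, h4⟩
  rw [Metric.mem_closedBall, dist_pi_le_iff hepos.le] at hz
  refine ⟨fun i => ?_, fun i => ?_⟩
  · have := abs_le.1 (Real.dist_eq _ _ ▸ hz i)
    linarith [hxQ.1 i, this.1]
  · have := abs_le.1 (Real.dist_eq _ _ ▸ hz i)
    have h5 := hxQ.2 i
    simp only at h5 ⊢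
    linarith [this.2]

theorem measurable_maxOp {n : ℕ} (f : (Fin n → ℝ) → ℝ≥0∞) : Measurable (maxOp f) :=
  measurable_of_Ioi fun t => (isOpen_maxOp f t).measurableSet

theorem ae_zero_of_bigQ {n : ℕ} {h : (Fin n → ℝ) → ℝ≥0∞} (hm : Measurable h)
    (H : ∀ N, ∃ M, N ≤ M ∧ cubeAvg h (bigQ n M) = 0) : h =ᵐ[volume] 0 := by
  have h1 : ∀ N, h =ᵐ[volume.restrict (bigQ n N)] 0 := by
    intro N
    obtain ⟨M, hNM, hM⟩ := H N
    have hv := cube_vol (bigQ_cube n M)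
    rw [cubeAvg, ENNReal.div_eq_zero_iff] at hM
    have h2 : ∫⁻ x in bigQ n N, h x = 0 :=
      le_antisymm ((lintegral_mono_set (bigQ_mono n hNM)).trans
        (hM.resolve_right hv.2).le) zero_le
    exact (lintegral_eq_zero_iff hm).1 h2
  have h3 := (ae_restrict_iUnion_iff (fun N => bigQ n N) (fun x => h x = 0)).2 h1
  rw [iUnion_bigQ, Measure.restrict_univ] at h3
  exact h3

theorem maxOp_pos {n : ℕ} {h : (Fin n → ℝ) → ℝ≥0∞} (hm : Measurable h)
    (h0 : ¬ h =ᵐ[volume] 0) (x : Fin n → ℝ) : 0 < maxOp h x := by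
  have : ¬ ∀ N, ∃ M, N ≤ M ∧ cubeAvg h (bigQ n M) = 0 := fun H => h0 (ae_zero_of_bigQ hm H)
  push Not at this
  obtain ⟨N, hN⟩ := this
  obtain ⟨N', hN'⟩ := exists_mem_bigQ x
  exact (pos_iff_ne_zero.2 (hN (max N N') (le_max_left _ _))).trans_le
    (cubeAvg_le_maxOp h (bigQ_cube n _) (hN' _ (le_max_right _ _)))

theorem maxOp_top {n : ℕ} {h : (Fin n → ℝ) → ℝ≥0∞} {Q : Set (Fin n → ℝ)} (hQ : IsCube Q)
    (hI : ∫⁻ x in Q, h x = ⊤) (x : Fin n → ℝ) : maxOp h x = ⊤ := by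
  obtain ⟨N, hN⟩ := cube_sub_bigQ hQ
  obtain ⟨N', hN'⟩ := exists_mem_bigQ x
  have h1 : ∫⁻ x in bigQ n (max N N'), h x = ⊤ :=
    top_le_iff.1 (hI ▸ lintegral_mono_set (hN _ (le_max_left _ _)))
  have h2 := cubeAvg_le_maxOp h (bigQ_cube n _) (hN' _ (le_max_right N N'))
  rw [cubeAvg, h1, ENNReal.top_div_of_ne_top (cube_vol (bigQ_cube n _)).2] at h2
  exact top_le_iff.1 h2

theorem cubeAvg_one {n : ℕ} {Q : Set (Fin n → ℝ)} (hQ : IsCube Q) :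
    cubeAvg (fun _ => (1 : ℝ≥0∞)) Q = 1 := by
  rw [cubeAvg]
  simp [ENNReal.div_self (cube_vol hQ).1 (cube_vol hQ).2]

theorem cubeAvg_const_mul {n : ℕ} {h : (Fin n → ℝ) → ℝ≥0∞} (hm : Measurable h) (c : ℝ≥0∞)
    (Q : Set (Fin n → ℝ)) : cubeAvg (fun x => c * h x) Q = c * cubeAvg h Q := by
  rw [cubeAvg, cubeAvg, lintegral_const_mul c hm, mul_div_assoc]

theorem maxOp_one {n : ℕ} (x : Fin n → ℝ) : maxOp (fun _ => (1 : ℝ≥0∞)) x = 1 := by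
  apply le_antisymm
  · exact iSup_le fun Q => iSup_le fun hQ => iSup_le fun _ => (cubeAvg_one hQ).le
  · obtain ⟨N, hN⟩ := exists_mem_bigQ x
    exact (cubeAvg_one (bigQ_cube n N)).ge.trans
      (cubeAvg_le_maxOp _ (bigQ_cube n N) (hN N le_rfl))

instance vol_ne_zero (n : ℕ) : NeZero (volume : Measure (Fin n → ℝ)) := by
  refine ⟨fun h => (cube_vol (bigQ_cube n 0)).1 ?_⟩
  rw [h]; rfl

theorem twoApC_one {n : ℕ} (p : ℝ) :
    twoApC (n := n) p (fun _ => 1) (fun _ => 1) = 1 := by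
  unfold twoApC
  split_ifs with h
  · apply le_antisymm
    · refine sInf_le ?_
      rw [Set.mem_ofPred_eq]
      exact Filter.Eventually.of_forall fun x => by simp [maxOp_one]
    · refine le_sInf fun C hC => ?_
      rw [Set.mem_ofPred_eq] at hC
      obtain ⟨x, hx⟩ := Filter.Eventually.exists hC
      simpa [maxOp_one] using hx
  · apply le_antisymm
    · refine iSup_le fun Q => iSup_le fun hQ => ?_
      simp [cubeAvg_one hQ]
    · refine le_iSup_of_le (bigQ n 0) (le_iSup_of_le (bigQ_cube n 0) ?_)
      simp [cubeAvg_one (bigQ_cube n 0)]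

/-- If `f = 0` a.e. then `g = 0` a.e. in the relevant sense. -/
theorem g_null {n : ℕ} {p : ℝ} (hp : 1 ≤ p) {f g : (Fin n → ℝ) → ℝ≥0∞}
    (H : ∀ u₁ u₂ : (Fin n → ℝ) → ℝ≥0∞, Measurable u₁ → Measurable u₂ →
      twoApC p u₁ u₂ = 1 → wkNorm p u₂ g ≤ stNorm p u₁ f)
    (hf0 : f =ᵐ[volume] 0) (y : ℝ≥0∞) (hy : 0 < y) : volume {x | y < g x} = 0 := by
  have h1 := H (fun _ => 1) (fun _ => 1) measurable_const measurable_const (twoApC_one p)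
  have h2 : stNorm p (fun _ => 1) f = 0 := by
    have : ∫⁻ x, f x ^ p * 1 = 0 := by
      rw [← lintegral_zero (μ := (volume : Measure (Fin n → ℝ)))]
      refine lintegral_congr_ae ?_
      filter_upwards [hf0] with x hx
      rw [hx]; simp [ENNReal.zero_rpow_of_pos (by linarith : 0 < p)]
    rw [stNorm, this, ENNReal.zero_rpow_of_pos (by positivity)]
  rw [h2] at h1
  have h3 := (le_iSup (fun y : ℝ≥0∞ => y * (wMeas (fun _ => 1) {x | y < g x}) ^ (1 / p)) y).trans h1
  have h4 := le_antisymm h3 zero_le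
  rw [mul_eq_zero] at h4
  have h5 := h4.resolve_left hy.ne'
  rw [ENNReal.rpow_eq_zero_iff] at h5
  have hpp : 0 < 1 / p := by positivity
  rcases h5 with h5 | h5
  · simpa [wMeas] using h5.1
  · linarith [h5.2]

/-- From constant `= 1` to constant `≤ 1` (case `p > 1`). -/
theorem from_le_one {n : ℕ} {p : ℝ} (hp : 1 < p) {f g : (Fin n → ℝ) → ℝ≥0∞} (hf : Measurable f)
    (H : ∀ u₁ u₂ : (Fin n → ℝ) → ℝ≥0∞, Measurable u₁ → Measurable u₂ →
      twoApC p u₁ u₂ = 1 → wkNorm p u₂ g ≤ stNorm p u₁ f)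
    (u₁ u₂ : (Fin n → ℝ) → ℝ≥0∞) (hu₁ : Measurable u₁) (hu₂ : Measurable u₂)
    (hK : twoApC p u₁ u₂ ≤ 1) (y : ℝ≥0∞) (hy : 0 < y) :
    y * (wMeas u₂ {x | y < g x}) ^ (1 / p) ≤ stNorm p u₁ f := by
  have hpp : 0 < 1 / p := by positivity
  have hexp : 1 - p / (p - 1) < 0 := by
    have : 1 < p / (p - 1) := by rw [lt_div_iff₀ (by linarith)]; linarith
    linarith
  by_cases hf0 : f =ᵐ[volume] 0
  · have h1 := g_null hp.le H hf0 y hy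
    have h2 : wMeas u₂ {x | y < g x} = 0 := by
      rw [wMeas]; exact setLIntegral_measure_zero _ _ h1
    rw [h2, ENNReal.zero_rpow_of_pos hpp, mul_zero]
    exact zero_le
  by_cases hK0 : twoApC p u₁ u₂ = 0
  · have hm : Measurable fun x => u₁ x ^ (1 - p / (p - 1)) := hu₁.pow_const _
    by_cases hu0 : u₂ =ᵐ[volume] 0
    · have h2 : wMeas u₂ {x | y < g x} = 0 := by
        rw [wMeas, lintegral_congr_ae (ae_restrict_of_ae hu0)]; simp
      rw [h2, ENNReal.zero_rpow_of_pos hpp, mul_zero]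
      exact zero_le
    have : ¬ ∀ N, ∃ M, N ≤ M ∧ cubeAvg u₂ (bigQ n M) = 0 := fun H => hu0 (ae_zero_of_bigQ hu₂ H)
    push Not at this
    obtain ⟨N, hN⟩ := this
    have h3 : (fun x => u₁ x ^ (1 - p / (p - 1))) =ᵐ[volume] 0 := by
      refine ae_zero_of_bigQ hm fun N' => ⟨max N N', le_max_right _ _, ?_⟩
      rw [twoApC, if_neg hp.ne'] at hK0
      simp only [ENNReal.iSup_eq_zero] at hK0
      have h4 := hK0 _ (bigQ_cube n (max N N'))
      rw [mul_eq_zero] at h4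
      have h5 := h4.resolve_left (hN _ (le_max_left _ _))
      rw [ENNReal.rpow_eq_zero_iff] at h5
      rcases h5 with h5 | h5
      · exact h5.1
      · linarith [h5.2]
    have h6 : stNorm p u₁ f = ⊤ := by
      rw [stNorm]
      have : ∫⁻ x, f x ^ p * u₁ x = ⊤ := by
        have h7 : ∫⁻ x, f x ^ p * u₁ x = ∫⁻ x, f x ^ p * ⊤ := by
          refine lintegral_congr_ae ?_
          filter_upwards [h3] with x hx
          have hx' : u₁ x ^ (1 - p / (p - 1)) = 0 := hx
          rw [ENNReal.rpow_eq_zero_iff] at hx'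
          rcases hx' with h | h
          · linarith [h.2]
          · rw [h.1]
        rw [h7, lintegral_mul_const _ (hf.pow_const p), ENNReal.mul_top]
        intro h8
        apply hf0
        filter_upwards [(lintegral_eq_zero_iff (hf.pow_const p)).1 h8] with x hx
        have hx' : f x ^ p = 0 := hx
        rw [ENNReal.rpow_eq_zero_iff] at hx'
        rcases hx' with h | h
        · exact h.1
        · linarith [h.2]
      rw [this, ENNReal.top_rpow_of_pos hpp]
    rw [h6]; exact le_top
  · set K := twoApC p u₁ u₂ with hKdef
    have hKt : K ≠ ⊤ := ne_top_of_le_ne_top ENNReal.one_ne_top hK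
    have h1 : twoApC p u₁ (fun x => K⁻¹ * u₂ x) = 1 := by
      have : twoApC p u₁ (fun x => K⁻¹ * u₂ x) = K⁻¹ * twoApC p u₁ u₂ := by
        rw [twoApC, twoApC, if_neg hp.ne', if_neg hp.ne']
        simp only [ENNReal.mul_iSup, cubeAvg_const_mul hu₂, mul_assoc]
      rw [this, ← hKdef, ENNReal.inv_mul_cancel hK0 hKt]
    have h2 := H u₁ (fun x => K⁻¹ * u₂ x) hu₁ (hu₂.const_mul _) h1
    refine le_trans ?_ h2
    refine le_trans ?_ (le_iSup (fun y : ℝ≥0∞ =>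
      y * (wMeas (fun x => K⁻¹ * u₂ x) {x | y < g x}) ^ (1 / p)) y)
    have : wMeas u₂ {x | y < g x} ≤ wMeas (fun x => K⁻¹ * u₂ x) {x | y < g x} := by
      refine lintegral_mono fun x => ?_
      have : 1 ≤ K⁻¹ := ENNReal.one_le_inv.2 hK
      calc u₂ x = 1 * u₂ x := (one_mul _).symm
        _ ≤ K⁻¹ * u₂ x := by gcongr
    gcongr

/-- The two-weight factorization with constant at most one. -/
theorem twoApC_factor {n : ℕ} {p : ℝ} (hp : 1 < p) {f w : (Fin n → ℝ) → ℝ≥0∞} (hf : Measurable f)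
    (hw : Measurable w) (hw0 : ¬ w =ᵐ[volume] 0)
    (hfi : ∀ Q : Set (Fin n → ℝ), IsCube Q → (∫⁻ x in Q, f x) ≠ ⊤)
    (hwi : ∀ Q : Set (Fin n → ℝ), IsCube Q → (∫⁻ x in Q, w x) ≠ ⊤) :
    twoApC p (fun x => maxOp w x * f x ^ (1 - p)) (fun x => w x * maxOp f x ^ (1 - p)) ≤ 1 := by
  have hp1 : 0 < p - 1 := by linarith
  have hexp : 1 - p / (p - 1) < 0 := by
    have : 1 < p / (p - 1) := by rw [lt_div_iff₀ (by linarith)]; linarith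
    linarith
  have hmul : (1 - p) * (1 - p / (p - 1)) = 1 := by field_simp; ring
  have hmul2 : (1 - p / (p - 1)) * (p - 1) = -1 := by field_simp; ring
  rw [twoApC, if_neg hp.ne']
  refine iSup_le fun Q => iSup_le fun hQ => ?_
  have hv := cube_vol hQ
  have hF : cubeAvg f Q ≠ ⊤ := ENNReal.div_ne_top (hfi Q hQ) hv.1
  have hW : cubeAvg w Q ≠ ⊤ := ENNReal.div_ne_top (hwi Q hQ) hv.1
  have h1 : cubeAvg (fun x => w x * maxOp f x ^ (1 - p)) Q
      ≤ cubeAvg f Q ^ (1 - p) * cubeAvg w Q := by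
    rw [← cubeAvg_const_mul hw]
    refine ENNReal.div_le_div_right (setLIntegral_mono' (cube_meas hQ) fun x hx => ?_) _
    rw [mul_comm]
    exact mul_le_mul_left (rpow_anti_neg (by linarith) (cubeAvg_le_maxOp f hQ hx)) _
  have h2 : cubeAvg (fun x => (maxOp w x * f x ^ (1 - p)) ^ (1 - p / (p - 1))) Q
      ≤ cubeAvg w Q ^ (1 - p / (p - 1)) * cubeAvg f Q := by
    rw [← cubeAvg_const_mul hf]
    refine ENNReal.div_le_div_right (setLIntegral_mono_ae' (cube_meas hQ) ?_) _
    have hft : ∀ᵐ x ∂(volume.restrict Q), f x < ⊤ := ae_lt_top hf (hfi Q hQ)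
    rw [ae_restrict_iff' (cube_meas hQ)] at hft
    filter_upwards [hft] with x hx hxQ
    have hfx := hx hxQ
    have hpos := maxOp_pos hw hw0 x
    have hne : f x ^ (1 - p) ≠ 0 := by
      intro h
      rw [ENNReal.rpow_eq_zero_iff] at h
      rcases h with h | h
      · linarith [h.2]
      · exact hfx.ne h.1
    have key : (maxOp w x * f x ^ (1 - p)) ^ (1 - p / (p - 1))
        = maxOp w x ^ (1 - p / (p - 1)) * f x := by
      by_cases hf0 : f x = 0
      · rw [hf0, ENNReal.zero_rpow_of_neg (by linarith), ENNReal.mul_top hpos.ne',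
          ENNReal.top_rpow_of_neg hexp, mul_zero]
      · by_cases hMt : maxOp w x = ⊤
        · rw [hMt, ENNReal.top_mul hne, ENNReal.top_rpow_of_neg hexp, zero_mul]
        · rw [ENNReal.mul_rpow_of_ne_top hMt
            (ENNReal.rpow_ne_top_of_ne_zero hf0 hfx.ne), ← ENNReal.rpow_mul, hmul,
            ENNReal.rpow_one]
    rw [key]
    exact mul_le_mul_left (rpow_anti_neg hexp.le (cubeAvg_le_maxOp w hQ hxQ)) _
  refine (mul_le_mul' h1 (ENNReal.rpow_le_rpow h2 hp1.le)).trans ?_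
  by_cases hW0 : cubeAvg w Q = 0
  · rw [hW0]; simp
  by_cases hF0 : cubeAvg f Q = 0
  · rw [hF0]; simp [ENNReal.zero_rpow_of_pos hp1]
  rw [ENNReal.mul_rpow_of_nonneg _ _ hp1.le, ← ENNReal.rpow_mul, hmul2, ENNReal.rpow_neg_one]
  have e1 : cubeAvg f Q ^ (1 - p) * cubeAvg f Q ^ (p - 1) = 1 := by
    rw [← ENNReal.rpow_add _ _ hF0 hF]; simp
  calc cubeAvg f Q ^ (1 - p) * cubeAvg w Q * ((cubeAvg w Q)⁻¹ * cubeAvg f Q ^ (p - 1))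
      = (cubeAvg f Q ^ (1 - p) * cubeAvg f Q ^ (p - 1)) * (cubeAvg w Q * (cubeAvg w Q)⁻¹) := by ring
    _ = 1 := by rw [e1, ENNReal.mul_inv_cancel hW0 hW, one_mul]
    _ ≤ 1 := le_rfl

theorem stmt6 {n : ℕ} (p₀ : ℝ) (hp₀ : 1 ≤ p₀)
    (f g : (Fin n → ℝ) → ℝ≥0∞) (hf : Measurable f) (hg : Measurable g)
    (H : ∀ u₁ u₂ : (Fin n → ℝ) → ℝ≥0∞, Measurable u₁ → Measurable u₂ →
      twoApC p₀ u₁ u₂ = 1 → wkNorm p₀ u₂ g ≤ stNorm p₀ u₁ f)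
    (u : (Fin n → ℝ) → ℝ≥0∞) (hu : PosLocInt u) :
    ∀ y : ℝ≥0∞, 0 < y →
      wMeas u {x | y < g x} ≤
        (if p₀ = 1 then 0 else 1) * wMeas u {x | y < maxOp f x}
          + y⁻¹ * ∫⁻ x, f x * maxOp (Set.indicator {x | y < g x} u) x := by
  intro y hy
  obtain ⟨hum, hupos, hui⟩ := hu
  set E : Set (Fin n → ℝ) := {x | y < g x} with hE
  have hEm : MeasurableSet E := measurableSet_lt measurable_const hg
  set w : (Fin n → ℝ) → ℝ≥0∞ := E.indicator u with hwdef
  have hw : Measurable w := hum.indicator hEm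
  have hwE : wMeas u E = ∫⁻ x, w x := (lintegral_indicator hEm u).symm
  by_cases hyt : y = ⊤
  · have : E = ∅ := by ext x; simp [hE, hyt]
    rw [wMeas, this]; simp
  by_cases hw0 : w =ᵐ[volume] 0
  · rw [hwE, lintegral_congr_ae hw0]; simp
  by_cases hf0 : f =ᵐ[volume] 0
  · have h1 := g_null hp₀ H hf0 y hy
    rw [wMeas, setLIntegral_measure_zero _ _ h1]; exact zero_le
  have hwi : ∀ Q : Set (Fin n → ℝ), IsCube Q → (∫⁻ x in Q, w x) ≠ ⊤ := by
    intro Q hQ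
    refine ((lintegral_mono fun x => ?_).trans_lt (hui Q hQ)).ne
    exact Set.indicator_le_self E u x
  by_cases hp1 : p₀ = 1
  · subst hp1
    simp only [if_true, zero_mul, zero_add]
    by_cases hMt : ∀ᵐ x ∂(volume : Measure (Fin n → ℝ)), maxOp w x = ⊤
    · have : ∫⁻ x, f x * maxOp w x = ⊤ := by
        have h7 : ∫⁻ x, f x * maxOp w x = ∫⁻ x, f x * ⊤ := by
          refine lintegral_congr_ae ?_
          filter_upwards [hMt] with x hx
          rw [hx]
        rw [h7, lintegral_mul_const _ hf, ENNReal.mul_top]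
        intro h8
        exact hf0 ((lintegral_eq_zero_iff hf).1 h8)
      rw [this, ENNReal.mul_top (ENNReal.inv_ne_zero.2 hyt)]
      exact le_top
    have hK : twoApC 1 (maxOp w) w = 1 := by
      rw [twoApC, if_pos rfl]
      apply le_antisymm
      · refine sInf_le ?_
        rw [Set.mem_ofPred_eq]
        exact Filter.Eventually.of_forall fun x => by simp
      · refine le_sInf fun C hC => ?_
        by_contra hlt
        push Not at hlt
        apply hMt
        filter_upwards [hC] with x hx
        by_contra hne
        have h1 : C * maxOp w x < 1 * maxOp w x :=
          ENNReal.mul_lt_mul_left (maxOp_pos hw hw0 x).ne' hne hlt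
        rw [one_mul] at h1
        exact absurd hx (not_le.2 h1)
    have h1 := H (maxOp w) w (measurable_maxOp w) hw hK
    have h2 := (le_iSup (fun y : ℝ≥0∞ => y * (wMeas w {x | y < g x}) ^ (1 / (1 : ℝ))) y).trans h1
    simp only [stNorm, div_one, ENNReal.rpow_one] at h2
    have h3 : wMeas w E = wMeas u E := by
      rw [wMeas, wMeas]
      exact setLIntegral_congr_fun hEm fun x hx => Set.indicator_of_mem hx u
    rw [← hE, h3] at h2
    rw [← ENNReal.div_eq_inv_mul, ENNReal.le_div_iff_mul_le (Or.inl hy.ne') (Or.inl hyt), mul_comm]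
    exact h2
  have hp : 1 < p₀ := lt_of_le_of_ne hp₀ (Ne.symm hp1)
  rw [if_neg hp1, one_mul]
  by_cases hfi : ∀ Q : Set (Fin n → ℝ), IsCube Q → (∫⁻ x in Q, f x) ≠ ⊤
  swap
  · push Not at hfi
    obtain ⟨Q, hQ, hQt⟩ := hfi
    have : {x | y < maxOp f x} = Set.univ := by
      ext x; simp [maxOp_top hQ hQt x, lt_top_iff_ne_top, hyt]
    rw [this]
    exact (lintegral_mono_set (Set.subset_univ _)).trans le_self_add
  have hK := twoApC_factor hp hf hw hw0 hfi hwi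
  have h1 := from_le_one hp hf H _ _ ((measurable_maxOp w).mul (hf.pow_const _))
    (hw.mul ((measurable_maxOp f).pow_const _)) hK y hy
  rw [← hE] at h1
  have hpos : 0 < p₀ := by linarith
  have h2 : y ^ p₀ * wMeas (fun x => w x * maxOp f x ^ (1 - p₀)) E
      ≤ ∫⁻ x, f x * maxOp w x := by
    have h3 := ENNReal.rpow_le_rpow h1 hpos.le
    rw [stNorm, ENNReal.mul_rpow_of_nonneg _ _ hpos.le, ← ENNReal.rpow_mul, ← ENNReal.rpow_mul,
      one_div, inv_mul_cancel₀ hpos.ne', ENNReal.rpow_one, ENNReal.rpow_one] at h3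
    refine h3.trans (lintegral_mono fun x => ?_)
    by_cases hx0 : f x = 0
    · simp [hx0, ENNReal.zero_rpow_of_pos hpos]
    by_cases hxt : f x = ⊤
    · simp [hxt, ENNReal.top_rpow_of_neg (by linarith : 1 - p₀ < 0)]
    · have : f x ^ p₀ * (maxOp w x * f x ^ (1 - p₀)) = f x * maxOp w x := by
        calc f x ^ p₀ * (maxOp w x * f x ^ (1 - p₀))
            = (f x ^ p₀ * f x ^ (1 - p₀)) * maxOp w x := by ring
          _ = f x * maxOp w x := by
            rw [← ENNReal.rpow_add _ _ hx0 hxt]; simp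
      exact this.le
  set G : Set (Fin n → ℝ) := {x | y < maxOp f x} with hG
  have hGm : MeasurableSet G := (isOpen_maxOp f y).measurableSet
  have h4 : wMeas u E ≤ wMeas u G + wMeas u (E ∩ Gᶜ) := by
    have : E ⊆ G ∪ (E ∩ Gᶜ) := by
      intro x hx
      by_cases h : x ∈ G
      · exact Or.inl h
      · exact Or.inr ⟨hx, h⟩
    exact (lintegral_mono_set this).trans (lintegral_union_le _ _ _)
  have h5 : y ^ (1 - p₀) * wMeas u (E ∩ Gᶜ)
      ≤ wMeas (fun x => w x * maxOp f x ^ (1 - p₀)) E := by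
    rw [wMeas, wMeas, ← lintegral_const_mul _ hum]
    refine le_trans ?_ (lintegral_mono_set (Set.inter_subset_left (s := E) (t := Gᶜ)))
    refine setLIntegral_mono' (hEm.inter hGm.compl) fun x hx => ?_
    have hwx : w x = u x := Set.indicator_of_mem hx.1 u
    rw [hwx, mul_comm]
    exact mul_le_mul_right (rpow_anti_neg (by linarith) (not_lt.1 hx.2)) _
  have h6 : y * wMeas u (E ∩ Gᶜ) ≤ ∫⁻ x, f x * maxOp w x := by
    refine le_trans ?_ h2
    calc y * wMeas u (E ∩ Gᶜ) = y ^ p₀ * (y ^ (1 - p₀) * wMeas u (E ∩ Gᶜ)) := by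
          rw [← mul_assoc, ← ENNReal.rpow_add _ _ hy.ne' hyt]; simp
      _ ≤ _ := by gcongr
  refine h4.trans ?_
  gcongr
  rw [← ENNReal.div_eq_inv_mul, ENNReal.le_div_iff_mul_le (Or.inl hy.ne') (Or.inl hyt), mul_comm]
  exact h6

end
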